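/- arXiv:2011.00131 — 2 statements merged into one kernel-verified Lean document; each statement's English description precedes it below -/
import Mathlib

section
/- (Lemma 1) Let V be a finite set with a metric cost function c, let T be a tree whose vertex set is a subset of V, let R be a nonempty subset of the vertex set of T, and let R' ⊆ R with |R ∖ R'| ≥ 2. Then for any two distinct u, v ∈ R ∖ R' there exists a Hamiltonian path on R from u to v whose cost is at most 2·c(T); in particular, every vertex of R' is an internal vertex of this path. -/
open scoped Classical

/-- The cost of a simple graph: the sum of the costs of its edges (for a
symmetric cost function, each unordered edge is counted once). -/
noncomputable def graphCost {α : Type*} [Fintype α] (c : α → α → ℝ) (G : SimpleGraph α) : ℝ :=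
  (∑ x : α, ∑ y : α, if G.Adj x y then c x y else 0) / 2

/-- The cost of a path given as a list of vertices: the sum of the costs of
its consecutive pairs. -/
def listCost {α : Type*} (c : α → α → ℝ) : List α → ℝ
  | [] => 0
  | [_] => 0
  | a :: b :: l => c a b + listCost c (b :: l)

theorem listCost_cons_le_of_sublist {α : Type*} {c : α → α → ℝ} (hnn : ∀ u v, 0 ≤ c u v)
    (htri : ∀ u v w, c u w ≤ c u v + c v w) {l₁ l₂ : List α} (h : l₁.Sublist l₂) (a : α) :
    listCost c (a :: l₁) ≤ listCost c (a :: l₂) := by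
  induction h generalizing a with
  | slnil => exact le_rfl
  | @cons l₁ l₂ b _ ih =>
    have hb := ih b
    cases l₁ with
    | nil =>
      simp only [listCost] at hb ⊢
      linarith [hnn a b]
    | cons d l =>
      simp only [listCost] at hb ⊢
      linarith [htri a b d]
  | cons_cons b _ ih =>
    simp only [listCost]
    linarith [ih b]

theorem listCost_map {α β : Type*} (c : β → β → ℝ) (f : α → β) (l : List α) :
    listCost c (l.map f) = listCost (fun a b => c (f a) (f b)) l := by
  induction l with
  | nil => rfl
  | cons a l ih => cases l <;> simp_all [listCost]

/-- A list from `u` to `v ≠ u` visiting all of `R` can be shortcut to a Hamiltonian path on `R`. -/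
theorem exists_nodup_listCost_le {V : Type*} {c : V → V → ℝ} (hnn : ∀ u v, 0 ≤ c u v)
    (htri : ∀ u v w, c u w ≤ c u v + c v w) (R : Finset V) {u v : V} (hu : u ∈ R) (hv : v ∈ R)
    (huv : u ≠ v) {L : List V} (hhead : L.head? = some u) (hlast : L.getLast? = some v)
    (hR : ∀ x ∈ R, x ∈ L) :
    ∃ l : List V, l.Nodup ∧ (∀ x, x ∈ l ↔ x ∈ R) ∧ l.head? = some u ∧ l.getLast? = some v ∧
      listCost c l ≤ listCost c L := by
  obtain ⟨m, rfl⟩ : ∃ m, L = u :: (m ++ [v]) := by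
    obtain ⟨t, rfl⟩ := List.head?_eq_some_iff.1 hhead
    obtain ⟨m, hm⟩ := List.getLast?_eq_some_iff.1 hlast
    cases m with
    | nil => simp_all
    | cons b m => exact ⟨m, by simp_all⟩
  refine ⟨u :: ((m.filter (fun x => x ∈ R ∧ x ≠ u ∧ x ≠ v)).dedup ++ [v]), ?_, ?_, rfl, ?_, ?_⟩
  · simp [List.nodup_append, List.nodup_dedup, huv]
  · intro x
    have := hR x
    simp only [List.mem_cons, List.mem_append, List.mem_dedup, List.mem_filter] at this ⊢
    by_cases x = u <;> by_cases x = v <;> simp_all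
  · rw [← List.cons_append, List.getLast?_append]
    simp
  · exact listCost_cons_le_of_sublist hnn htri
      (((List.dedup_sublist _).trans List.filter_sublist).append_right _) u

/-- The cost of a walk in a graph: the sum of the costs of its darts. -/
def SimpleGraph.Walk.cost {α : Type*} {G : SimpleGraph α} (c : α → α → ℝ) {u v : α}
    (p : G.Walk u v) : ℝ :=
  (p.darts.map fun d => c d.fst d.snd).sum

theorem SimpleGraph.Walk.listCost_support {α : Type*} {G : SimpleGraph α} (c : α → α → ℝ) {u v : α}
    (p : G.Walk u v) : listCost c p.support = p.cost c := by
  induction p with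
  | nil => simp [listCost, cost]
  | cons h p ih =>
    rw [SimpleGraph.Walk.support_cons]
    cases p <;> simp_all [listCost, cost]

/-- If every two vertices of `A` are joined by a walk visiting all of `A`, then the same holds for
`insert x A` with `x` adjacent to `a ∈ A`, at an additional cost of at most `2 * c a x`. -/
theorem SimpleGraph.exists_walk_cost_le_insert {α : Type*} {G : SimpleGraph α} {c : α → α → ℝ}
    (hnn : ∀ u v, 0 ≤ c u v) (hsymm : ∀ u v, c u v = c v u) {A : Finset α} {b : ℝ}
    (hA : ∀ u ∈ A, ∀ v ∈ A, ∃ p : G.Walk u v, (∀ y ∈ A, y ∈ p.support) ∧ p.cost c ≤ b)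
    {a x : α} (ha : a ∈ A) (hax : G.Adj a x) :
    ∀ u ∈ insert x A, ∀ v ∈ insert x A, ∃ p : G.Walk u v,
      (∀ y ∈ insert x A, y ∈ p.support) ∧ p.cost c ≤ b + 2 * c a x := by
  have hc := hnn a x
  have hs := hsymm x a
  intro u hu v hv
  rcases Finset.mem_insert.1 hu with rfl | huA <;> rcases Finset.mem_insert.1 hv with rfl | hvA
  · obtain ⟨p, hp, hpc⟩ := hA a ha a ha
    refine ⟨.cons hax.symm (p.append (.cons hax .nil)), ?_, ?_⟩
    · intro y hy
      rcases Finset.mem_insert.1 hy with rfl | hy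
      · simp
      · simp [Walk.mem_support_append_iff, hp y hy]
    · simp [Walk.cost] at hpc ⊢
      linarith
  · obtain ⟨p, hp, hpc⟩ := hA a ha v hvA
    refine ⟨.cons hax.symm p, ?_, ?_⟩
    · intro y hy
      rcases Finset.mem_insert.1 hy with rfl | hy
      · simp
      · simp [hp y hy]
    · simp [Walk.cost] at hpc ⊢
      linarith
  · obtain ⟨p, hp, hpc⟩ := hA u huA a ha
    refine ⟨p.append (.cons hax .nil), ?_, ?_⟩
    · intro y hy
      rcases Finset.mem_insert.1 hy with rfl | hy
      · simp
      · simp [Walk.mem_support_append_iff, hp y hy]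
    · simp [Walk.cost] at hpc ⊢
      linarith
  · obtain ⟨p, hp, hpc⟩ := hA u huA v hvA
    obtain ⟨q, r, rfl⟩ := Walk.mem_support_iff_exists_append.1 (hp a ha)
    refine ⟨q.append (.cons hax (.cons hax.symm r)), ?_, ?_⟩
    · intro y hy
      rcases Finset.mem_insert.1 hy with rfl | hy
      · simp [Walk.mem_support_append_iff]
      · rcases (Walk.mem_support_append_iff _ _).1 (hp y hy) with h | h <;>
          simp [Walk.mem_support_append_iff, h]
    · simp [Walk.cost] at hpc ⊢
      linarith

theorem SimpleGraph.sum_adj_add_le_insert {α : Type*} (G : SimpleGraph α) {c : α → α → ℝ}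
    (hnn : ∀ u v, 0 ≤ c u v) (hsymm : ∀ u v, c u v = c v u) {A : Finset α} {a x : α}
    (ha : a ∈ A) (hx : x ∉ A) (hax : G.Adj a x) :
    (∑ y ∈ A, ∑ z ∈ A, if G.Adj y z then c y z else 0) + 2 * c a x ≤
      ∑ y ∈ insert x A, ∑ z ∈ insert x A, if G.Adj y z then c y z else 0 := by
  have hpos (y z : α) : 0 ≤ if G.Adj y z then c y z else 0 := by
    split_ifs <;> simp [hnn]
  have h₁ := Finset.single_le_sum (fun z _ => hpos x z) ha
  have h₂ := Finset.single_le_sum (fun z _ => hpos z x) ha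
  simp only [Finset.sum_insert hx, Finset.sum_add_distrib]
  simp only [hax, hax.symm, if_true, SimpleGraph.irrefl, if_false] at h₁ h₂ ⊢
  linarith [hsymm x a]

theorem SimpleGraph.Connected.exists_walk_cost_le {α : Type*} [Fintype α] {G : SimpleGraph α}
    (hG : G.Connected) {c : α → α → ℝ} (hnn : ∀ u v, 0 ≤ c u v) (hsymm : ∀ u v, c u v = c v u)
    (u v : α) : ∃ p : G.Walk u v, (∀ y, y ∈ p.support) ∧ p.cost c ≤ 2 * graphCost c G := by
  have key (n : ℕ) (hn : n < Fintype.card α) : ∃ A : Finset α, A.card = n + 1 ∧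
      ∀ u ∈ A, ∀ v ∈ A, ∃ p : G.Walk u v, (∀ y ∈ A, y ∈ p.support) ∧
        p.cost c ≤ ∑ y ∈ A, ∑ z ∈ A, if G.Adj y z then c y z else 0 := by
    induction n with
    | zero =>
      refine ⟨{u}, rfl, fun w hw z hz => ?_⟩
      obtain rfl := Finset.mem_singleton.1 hw
      obtain rfl := Finset.mem_singleton.1 hz
      exact ⟨.nil, by simp, by simp [Walk.cost]⟩
    | succ n ih =>
      obtain ⟨A, hcard, hA⟩ := ih (by omega)
      obtain ⟨w, hw⟩ : A.Nonempty := Finset.card_pos.1 (by omega)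
      obtain ⟨z, hz⟩ : ∃ z, z ∉ A := by
        by_contra! h
        rw [Finset.eq_univ_iff_forall.2 h, Finset.card_univ] at hcard
        omega
      obtain ⟨p⟩ := hG.preconnected w z
      obtain ⟨d, -, hd₁, hd₂⟩ := p.exists_boundary_dart (A : Set α) hw hz
      refine ⟨insert d.snd A, by rw [Finset.card_insert_of_notMem hd₂, hcard], fun w hw z hz => ?_⟩
      obtain ⟨q, hq, hqc⟩ := exists_walk_cost_le_insert hnn hsymm hA hd₁ d.adj w hw z hz
      exact ⟨q, hq, hqc.trans (G.sum_adj_add_le_insert hnn hsymm hd₁ hd₂ d.adj)⟩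
  have hpos : 0 < Fintype.card α := Fintype.card_pos_iff.2 ⟨u⟩
  obtain ⟨A, hcard, hA⟩ := key (Fintype.card α - 1) (by omega)
  obtain rfl : A = Finset.univ := (Finset.card_eq_iff_eq_univ A).1 (by omega)
  obtain ⟨p, hp, hpc⟩ := hA u (Finset.mem_univ u) v (Finset.mem_univ v)
  refine ⟨p, fun y => hp y (Finset.mem_univ y), hpc.trans_eq ?_⟩
  rw [graphCost]
  ring

/-- Lemma 1: given a tree `T` on a vertex set `S ⊆ V`, a nonempty set
`R ⊆ S` of terminals and `R' ⊆ R` with `|R \ R'| ≥ 2`, for any two distinct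
`u, v ∈ R \ R'` there is a Hamiltonian path on `R` from `u` to `v` of cost at
most `2 · c(T)`; in particular every vertex of `R'` is internal in it. -/
theorem ham_path_on_terminals_of_tree {V : Type*} [Fintype V] [DecidableEq V]
    (c : V → V → ℝ)
    (hnn : ∀ u v, 0 ≤ c u v) (hsymm : ∀ u v, c u v = c v u)
    (hrefl : ∀ v, c v v = 0) (htri : ∀ u v w, c u w ≤ c u v + c v w)
    (S : Finset V) (T : SimpleGraph {x : V // x ∈ S}) (hT : T.IsTree)
    (R R' : Finset V) (hRS : R ⊆ S) (hRne : R.Nonempty) (hR'R : R' ⊆ R)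
    (hcard : 2 ≤ (R \ R').card)
    (u v : V) (hu : u ∈ R \ R') (hv : v ∈ R \ R') (huv : u ≠ v) :
    ∃ l : List V, l.Nodup ∧ (∀ x, x ∈ l ↔ x ∈ R) ∧
      l.head? = some u ∧ l.getLast? = some v ∧
      listCost c l ≤ 2 * graphCost (fun a b => c a.1 b.1) T ∧
      (∀ x ∈ R', x ∈ l ∧ x ≠ u ∧ x ≠ v) := by
  rw [Finset.mem_sdiff] at hu hv
  obtain ⟨p, hp, hpc⟩ := hT.connected.exists_walk_cost_le (c := fun a b => c a.1 b.1)
    (fun _ _ => hnn _ _) (fun _ _ => hsymm _ _) ⟨u, hRS hu.1⟩ ⟨v, hRS hv.1⟩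
  rw [← p.listCost_support, ← listCost_map c Subtype.val] at hpc
  obtain ⟨l, hnodup, hmem, hhead, hlast, hcost⟩ :=
    exists_nodup_listCost_le hnn htri R hu.1 hv.1 huv (L := p.support.map Subtype.val)
      (by rw [List.head?_map, List.head?_eq_some_head p.support_ne_nil, p.head_support]; rfl)
      (by rw [List.getLast?_map, List.getLast?_eq_some_getLast p.support_ne_nil,
        p.getLast_support]; rfl)
      (fun x hx => List.mem_map.2 ⟨⟨x, hRS hx⟩, hp _, rfl⟩)
  refine ⟨l, hnodup, hmem, hhead, hlast, hcost.trans hpc, fun x hx => ⟨(hmem x).2 (hR'R hx), ?_, ?_⟩⟩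
  · rintro rfl
    exact hu.2 hx
  · rintro rfl
    exact hv.2 hx
end

section
/- Let R be a finite set with a metric cost function c, with |R| ≥ 2, and let R' ⊆ R with |R ∖ R'| ≥ 2. Then for any two distinct u, v ∈ R ∖ R' there exists a Hamiltonian path on R from u to v whose cost is at most 2·mst(R), where mst(R) is the minimum cost of a tree with vertex set exactly R. -/
open scoped Classical

/-- The minimum cost of a spanning tree of the whole finite set `R`. -/
noncomputable def mstCostAll {R : Type*} [Fintype R] (c : R → R → ℝ) : ℝ :=
  sInf {x : ℝ | ∃ T : SimpleGraph R, T.IsTree ∧ graphCost c T = x}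

/-- `IsHamPath S u v l` says that `l` lists each element of `S` exactly once, starting at `u` and
ending at `v`. -/
structure IsHamPath {R : Type*} (S : Finset R) (u v : R) (l : List R) : Prop where
  nodup : l.Nodup
  mem_iff : ∀ x, x ∈ l ↔ x ∈ S
  head : l.head? = some u
  last : l.getLast? = some v

theorem listCost_append_pair {R : Type*} (c : R → R → ℝ) (l : List R) (a b : R) :
    listCost c (l ++ [a, b]) = listCost c (l ++ [a]) + c a b := by
  induction l with
  | nil => simp [listCost]
  | cons x l ih =>
    cases l with
    | nil => simp [listCost]
    | cons y l =>
      simp only [List.cons_append, listCost] at ih ⊢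
      rw [ih, add_assoc]

theorem listCost_reverse {R : Type*} (c : R → R → ℝ) (hsymm : ∀ u v, c u v = c v u) (l : List R) :
    listCost c l.reverse = listCost c l := by
  induction l with
  | nil => rfl
  | cons a l ih =>
    cases l with
    | nil => rfl
    | cons b l =>
      simp only [List.reverse_cons, List.append_assoc, List.cons_append, List.nil_append] at ih ⊢
      rw [listCost_append_pair, ih, listCost, hsymm b a, add_comm]

namespace IsHamPath

variable {R : Type*} {S : Finset R} {u v x : R} {l : List R}

theorem singleton (u : R) : IsHamPath {u} u u [u] :=
  ⟨by simp, by simp, rfl, rfl⟩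

theorem reverse (h : IsHamPath S u v l) : IsHamPath S v u l.reverse :=
  ⟨List.nodup_reverse.2 h.nodup, by simp [h.mem_iff], by simp [h.last], by simp [h.head]⟩

theorem cons [DecidableEq R] (h : IsHamPath S u v l) (hx : x ∉ S) :
    IsHamPath (insert x S) x v (x :: l) := by
  refine ⟨List.nodup_cons.2 ⟨fun hl => hx ((h.mem_iff x).1 hl), h.nodup⟩, ?_, rfl, ?_⟩
  · simp [h.mem_iff]
  · simp [List.getLast?_cons, h.last]

end IsHamPath

theorem listCost_cons_of_head {R : Type*} (c : R → R → ℝ) {u : R} {l : List R}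
    (h : l.head? = some u) (x : R) : listCost c (x :: l) = c x u + listCost c l := by
  cases l with
  | nil => simp at h
  | cons a l =>
    obtain rfl : a = u := by simpa using h
    rfl

/-- A vertex `x` can be inserted next to `y` between two entries of a list with at least two entries, at
the price of traversing the edge `x y` twice. -/
theorem exists_perm_cons_listCost_le {R : Type*} (c : R → R → ℝ)
    (hsymm : ∀ u v, c u v = c v u) (htri : ∀ u v w, c u w ≤ c u v + c v w) (x y : R)
    (a b : R) (t : List R) (hy : y ∈ a :: b :: t) :
    ∃ t', (a :: t').Perm (x :: a :: b :: t) ∧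
      (a :: t').getLast? = (a :: b :: t).getLast? ∧
      listCost c (a :: t') ≤ listCost c (a :: b :: t) + 2 * c x y := by
  induction t generalizing a b with
  | nil =>
    refine ⟨[x, b], List.Perm.swap _ _ _, by simp, ?_⟩
    simp only [listCost]
    have h₁ := htri x a b
    have h₂ := htri a b x
    have h₃ := hsymm a x
    have h₄ := hsymm b x
    rcases List.mem_pair.1 hy with rfl | rfl <;> linarith
  | cons d t ih =>
    by_cases hyt : y ∈ b :: d :: t
    · obtain ⟨t', hp, hl, hc⟩ := ih b d hyt
      refine ⟨b :: t', (hp.cons a).trans (List.Perm.swap _ _ _), ?_, ?_⟩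
      · simpa [List.getLast?_cons] using hl
      · simp only [listCost] at hc ⊢
        linarith
    · obtain rfl : y = a := (List.mem_cons.1 hy).resolve_right hyt
      refine ⟨x :: b :: d :: t, List.Perm.swap _ _ _, by simp [List.getLast?_cons], ?_⟩
      simp only [listCost]
      have h₁ := htri x y b
      have h₂ := hsymm y x
      linarith

/-- Any two vertices of `S`, distinct unless `S` is a singleton, are joined by a Hamiltonian path
on `S` whose closure to a cycle costs at most the total weight of `f` on `S × S`. -/
def HasCheapHamPaths {R : Type*} (c f : R → R → ℝ) (S : Finset R) : Prop :=
  ∀ u ∈ S, ∀ v ∈ S, (u = v → S = {u}) →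
    ∃ l, IsHamPath S u v l ∧ listCost c l + c u v ≤ ∑ a ∈ S, ∑ b ∈ S, f a b

theorem HasCheapHamPaths.insert {R : Type*} [DecidableEq R] {c f : R → R → ℝ}
    (hsymm : ∀ u v, c u v = c v u) (hrefl : ∀ v, c v v = 0)
    (htri : ∀ u v w, c u w ≤ c u v + c v w) (hf : ∀ a b, 0 ≤ f a b) {S : Finset R} {x y : R}
    (hx : x ∉ S) (hy : y ∈ S) (hxy : c x y ≤ f x y) (hyx : c y x ≤ f y x)
    (h : HasCheapHamPaths c f S) : HasCheapHamPaths c f (insert x S) := by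
  have hW : ∑ a ∈ S, ∑ b ∈ S, f a b + 2 * c x y ≤
      ∑ a ∈ Insert.insert x S, ∑ b ∈ Insert.insert x S, f a b := by
    simp only [Finset.sum_insert hx, Finset.sum_add_distrib]
    have h₁ := Finset.single_le_sum (f := fun b => f x b) (fun b _ => hf x b) hy
    have h₂ := Finset.single_le_sum (f := fun a => f a x) (fun a _ => hf a x) hy
    have h₃ := hf x x
    have h₄ := hsymm x y
    linarith
  have hstart : ∀ v ∈ S, ∃ l, IsHamPath (Insert.insert x S) x v l ∧
      listCost c l + c x v ≤ ∑ a ∈ Insert.insert x S, ∑ b ∈ Insert.insert x S, f a b := by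
    intro v hv
    have key : ∀ z ∈ S, (z = v → S = {z}) → c x z + c x v ≤ 2 * c x y + c z v →
        ∃ l, IsHamPath (Insert.insert x S) x v l ∧
          listCost c l + c x v ≤ ∑ a ∈ Insert.insert x S, ∑ b ∈ Insert.insert x S, f a b := by
      intro z hz hzv hle
      obtain ⟨l, hl, hc⟩ := h z hz v hv hzv
      refine ⟨x :: l, hl.cons hx, ?_⟩
      rw [listCost_cons_of_head c hl.head]
      linarith
    by_cases hyv : y = v
    · subst hyv
      by_cases hS : S = {y}
      · exact key y hy (fun _ => hS) (by linarith [hrefl y])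
      · obtain ⟨z, hz, hzy⟩ : ∃ z ∈ S, z ≠ y := by
          by_contra! hall
          exact hS (Finset.eq_singleton_iff_unique_mem.2 ⟨hy, hall⟩)
        exact key z hz (fun e => absurd e hzy) (by linarith [htri x y z, hsymm y z])
    · exact key y hy (fun e => absurd e hyv) (by linarith [htri x y v])
  intro u hu v hv huv
  rcases Finset.mem_insert.1 hu with rfl | huS
  · rcases Finset.mem_insert.1 hv with rfl | hvS
    · have hy' : y ∈ ({v} : Finset R) := huv rfl ▸ Finset.mem_insert_of_mem hy
      exact absurd (Finset.mem_singleton.1 hy' ▸ hy) hx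
    · exact hstart v hvS
  · rcases Finset.mem_insert.1 hv with rfl | hvS
    · obtain ⟨l, hl, hc⟩ := hstart u huS
      exact ⟨l.reverse, hl.reverse, by rwa [listCost_reverse c hsymm, hsymm u v]⟩
    · have hne : u ≠ v := by
        intro e
        have hx' : x ∈ ({u} : Finset R) := huv e ▸ Finset.mem_insert_self x S
        exact hx (Finset.mem_singleton.1 hx' ▸ huS)
      obtain ⟨l, hl, hc⟩ := h u huS v hvS (fun e => absurd e hne)
      obtain ⟨b, t, rfl⟩ : ∃ b t, l = u :: b :: t := by
        have h₁ := hl.head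
        have h₂ := hl.last
        match l with
        | [] => simp at h₁
        | [a] => simp_all
        | a :: b :: t => exact ⟨b, t, by simpa using h₁⟩
      obtain ⟨t', hp, hlast, hc'⟩ :=
        exists_perm_cons_listCost_le c hsymm htri x y u b t ((hl.mem_iff y).2 hy)
      refine ⟨u :: t', ⟨hp.nodup_iff.2 (hl.cons hx).nodup, fun z => ?_, rfl, hlast.trans hl.last⟩,
        by linarith⟩
      rw [hp.mem_iff, (hl.cons hx).mem_iff]

theorem SimpleGraph.Connected.hasCheapHamPaths_univ {R : Type*} [Fintype R] {c : R → R → ℝ}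
    (hnn : ∀ u v, 0 ≤ c u v) (hsymm : ∀ u v, c u v = c v u) (hrefl : ∀ v, c v v = 0)
    (htri : ∀ u v w, c u w ≤ c u v + c v w) {G : SimpleGraph R} (hG : G.Connected) :
    HasCheapHamPaths c (fun x y => if G.Adj x y then c x y else 0) Finset.univ := by
  set f : R → R → ℝ := fun x y => if G.Adj x y then c x y else 0 with hfdef
  have hf : ∀ a b, 0 ≤ f a b := fun a b => by
    simp only [hfdef]
    split_ifs
    exacts [hnn a b, le_rfl]
  obtain ⟨r⟩ := hG.nonempty
  have hr : HasCheapHamPaths c f {r} := by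
    intro u hu v hv _
    obtain rfl := Finset.mem_singleton.1 hu
    obtain rfl := Finset.mem_singleton.1 hv
    exact ⟨[v], IsHamPath.singleton v, by simpa [listCost, hrefl] using hf v v⟩
  obtain ⟨S, ⟨hrS, hS⟩, hmax⟩ :=
    (Set.toFinite {S : Finset R | r ∈ S ∧ HasCheapHamPaths c f S}).exists_maximal
      ⟨{r}, Finset.mem_singleton_self r, hr⟩
  suffices S = Finset.univ from this ▸ hS
  by_contra hne
  obtain ⟨z, hz⟩ : ∃ z, z ∉ S := by
    simpa [Finset.eq_univ_iff_forall] using hne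
  obtain ⟨p⟩ := hG.preconnected r z
  obtain ⟨d, -, hd₁, hd₂⟩ := p.exists_boundary_dart (S : Set R) hrS hz
  have hd₂' : d.snd ∉ S := hd₂
  have hins := hS.insert hsymm hrefl htri hf hd₂' hd₁
    (by simp [hfdef, d.adj.symm]) (by simp [hfdef, d.adj])
  exact hd₂' (hmax ⟨Finset.mem_insert_of_mem hrS, hins⟩ (Finset.subset_insert _ _)
    (Finset.mem_insert_self _ _))

/-- For a finite metric space `R` with `|R| ≥ 2` and `R' ⊆ R` with
`|R \ R'| ≥ 2`, any two distinct `u, v ∈ R \ R'` are joined by a Hamiltonian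
path on `R` of cost at most `2 · mst(R)`. -/
theorem ham_path_le_two_mst {R : Type*} [Fintype R] [DecidableEq R]
    (c : R → R → ℝ)
    (hnn : ∀ u v, 0 ≤ c u v) (hsymm : ∀ u v, c u v = c v u)
    (hrefl : ∀ v, c v v = 0) (htri : ∀ u v w, c u w ≤ c u v + c v w)
    (h2 : 2 ≤ Fintype.card R)
    (R' : Finset R) (hcard : 2 ≤ (Finset.univ \ R').card)
    (u v : R) (hu : u ∉ R') (hv : v ∉ R') (huv : u ≠ v) :
    ∃ l : List R, l.Nodup ∧ (∀ x : R, x ∈ l) ∧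
      l.head? = some u ∧ l.getLast? = some v ∧
      listCost c l ≤ 2 * mstCostAll c := by
  have : Nonempty R := ⟨u⟩
  have hfin : {x : ℝ | ∃ T : SimpleGraph R, T.IsTree ∧ graphCost c T = x}.Finite :=
    (Set.toFinite (Set.range (graphCost c))).subset fun _ ⟨T, _, hT⟩ => ⟨T, hT⟩
  obtain ⟨T₀, -, hT₀⟩ := (SimpleGraph.connected_top (V := R)).exists_isTree_le
  obtain ⟨T, hT, hcost⟩ : mstCostAll c ∈ {x : ℝ | ∃ T : SimpleGraph R, T.IsTree ∧
      graphCost c T = x} := Set.Nonempty.csInf_mem ⟨_, T₀, hT₀, rfl⟩ hfin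
  obtain ⟨l, hl, hc⟩ := hT.connected.hasCheapHamPaths_univ hnn hsymm hrefl htri
    u (Finset.mem_univ u) v (Finset.mem_univ v) (fun e => absurd e huv)
  refine ⟨l, hl.nodup, fun x => (hl.mem_iff x).2 (Finset.mem_univ x), hl.head, hl.last, ?_⟩
  rw [← hcost, graphCost]
  linarith [hnn u v]
end
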